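/- Let Q = [0,1] × [0,1] ⊆ ℝ². For every continuous map f : Q → Q and every ε > 0 there exist real polynomials p₁, p₂ in two variables such that the map p = (p₁, p₂) maps Q into Q with sup_{z ∈ Q} ‖f(z) − p(z)‖ ≤ ε, and such that the sets C₁ = {(x, y) ∈ Q | p₁(x, y) = x} and C₂ = {(x, y) ∈ Q | p₂(x, y) = y} satisfy: C₁ ∩ C₂ ≠ ∅ (every point of C₁ ∩ C₂ is a fixed point of p), and each of Q ∖ C₁ and Q ∖ C₂ has at least two connected components. -/

import Mathlib

open Set

/-- A continuous nonvanishing complex function on a compact set that is star-shaped about the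
origin has a continuous logarithm. -/
lemma exists_continuousOn_exp_eq {E : Type*} [NormedAddCommGroup E] [NormedSpace ℝ E]
    {K : Set E} (hK : IsCompact K) (hstar : ∀ z ∈ K, ∀ t ∈ Icc (0 : ℝ) 1, t • z ∈ K)
    {F : E → ℂ} (hF : ContinuousOn F K) (hF0 : ∀ z ∈ K, F z ≠ 0) :
    ∃ g : E → ℂ, ContinuousOn g K ∧ ∀ z ∈ K, Complex.exp (g z) = F z := by
  rcases K.eq_empty_or_nonempty with rfl | hne
  · exact ⟨0, by simp, by simp⟩
  obtain ⟨w, hw, hmin⟩ := hK.exists_isMinOn hne hF.norm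
  have hm : 0 < ‖F w‖ := norm_pos_iff.mpr (hF0 w hw)
  obtain ⟨δ, hδ, hu⟩ := Metric.uniformContinuousOn_iff.mp
    (hK.uniformContinuousOn_of_continuous hF) ‖F w‖ hm
  obtain ⟨R, hR⟩ := hK.isBounded.exists_norm_le
  obtain ⟨N, hN⟩ := exists_nat_gt (max 0 (R / δ))
  have hN0 : (0 : ℝ) < N := lt_of_le_of_lt (le_max_left _ _) hN
  have hRN : R < N * δ := (div_lt_iff₀ hδ).mp (lt_of_le_of_lt (le_max_right _ _) hN)
  have hmem : ∀ k : ℕ, k ≤ N → ∀ z ∈ K, ((k : ℝ) / N) • z ∈ K := fun k hk z hz =>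
    hstar z hz _ ⟨by positivity, (div_le_one hN0).mpr (by exact_mod_cast hk)⟩
  have hslit : ∀ k < N, ∀ z ∈ K,
      F (((k + 1 : ℕ) / N : ℝ) • z) / F ((k / N : ℝ) • z) ∈ Complex.slitPlane := by
    intro k hk z hz
    have h1 := hmem (k + 1) hk z hz
    have h0 := hmem k hk.le z hz
    have hd : dist (((k + 1 : ℕ) / N : ℝ) • z) ((k / N : ℝ) • z) < δ := by
      rw [dist_eq_norm, ← sub_smul, norm_smul]
      have : ((k + 1 : ℕ) / N : ℝ) - k / N = 1 / N := by push_cast; ring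
      rw [this, Real.norm_of_nonneg (by positivity), one_div_mul_eq_div, div_lt_iff₀ hN0]
      linarith [hR z hz]
    have hlt := hu _ h1 _ h0 hd
    rw [dist_eq_norm] at hlt
    have hle : ‖F w‖ ≤ ‖F ((k / N : ℝ) • z)‖ := hmin h0
    have hne := hF0 _ h0
    have := Complex.mem_slitPlane_of_norm_lt_one
      (z := (F (((k + 1 : ℕ) / N : ℝ) • z) - F ((k / N : ℝ) • z)) / F ((k / N : ℝ) • z))
      (by rw [norm_div, div_lt_one (norm_pos_iff.mpr hne)]; exact hlt.trans_le hle)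
    rwa [sub_div, div_self hne, add_sub_cancel] at this
  refine ⟨fun z => Complex.log (F 0) + ∑ k ∈ Finset.range N,
    Complex.log (F (((k + 1 : ℕ) / N : ℝ) • z) / F ((k / N : ℝ) • z)), ?_, ?_⟩
  · refine continuousOn_const.add (continuousOn_finsetSum _ fun k hk => ?_)
    have hk := Finset.mem_range.mp hk
    refine ContinuousOn.clog ?_ (hslit k hk)
    refine ContinuousOn.div ?_ ?_ fun z hz => hF0 _ (hmem k hk.le z hz)
    · exact hF.comp (by fun_prop) (hmem (k + 1) hk)
    · exact hF.comp (by fun_prop) (hmem k hk.le)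
  · intro z hz
    have hz0 : F 0 ≠ 0 := hF0 0 (by simpa using hmem 0 (Nat.zero_le _) z hz)
    rw [Complex.exp_add, Complex.exp_log hz0, Complex.exp_sum]
    have : ∏ k ∈ Finset.range N,
        Complex.exp (Complex.log (F (((k + 1 : ℕ) / N : ℝ) • z) / F ((k / N : ℝ) • z))) =
        F z / F 0 := by
      rw [Finset.prod_congr rfl fun k hk => Complex.exp_log
        (Complex.slitPlane_ne_zero (hslit k (Finset.mem_range.mp hk) z hz))]
      have key : ∀ n ≤ N, ∏ k ∈ Finset.range n,
          (F (((k + 1 : ℕ) / N : ℝ) • z) / F ((k / N : ℝ) • z)) = F ((n / N : ℝ) • z) / F 0 := by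
        intro n hn
        induction n with
        | zero => simp [hz0]
        | succ n ih =>
          rw [Finset.prod_range_succ, ih (by lia)]
          have := hF0 _ (hmem n (by lia) z hz)
          field_simp
      have := key N le_rfl
      rwa [div_self hN0.ne', one_smul] at this
    rw [this]
    field_simp

/-- A continuous real function on a preconnected set whose sine is positive takes its values in
a single interval on which the sine is positive. -/
lemma exists_int_forall_mem_Ioo_of_sin_pos {X : Type*} [TopologicalSpace X] {s : Set X}
    (hs : IsPreconnected s) {h : X → ℝ} (hh : ContinuousOn h s)
    (hsin : ∀ x ∈ s, 0 < Real.sin (h x)) :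
    ∃ k : ℤ, ∀ x ∈ s, h x ∈ Ioo (2 * Real.pi * k) (2 * Real.pi * k + Real.pi) := by
  rcases s.eq_empty_or_nonempty with rfl | ⟨x₀, hx₀⟩
  · exact ⟨0, by simp⟩
  have hpi := Real.pi_pos
  set k : ℤ := ⌊h x₀ / (2 * Real.pi)⌋ with hk
  have hsin0 (n : ℤ) : Real.sin (2 * Real.pi * n) = 0 := by
    have := Real.sin_int_mul_pi (2 * n)
    rw [← this]; push_cast; congr 1; ring
  have hsin1 (n : ℤ) : Real.sin (2 * Real.pi * n + Real.pi) = 0 := by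
    rw [Real.sin_add_pi, hsin0, neg_zero]
  have hlo : 2 * Real.pi * k ≤ h x₀ := by
    have := (le_div_iff₀ (by positivity)).mp (Int.floor_le (h x₀ / (2 * Real.pi)))
    linarith
  have hhi : h x₀ < 2 * Real.pi * k + 2 * Real.pi := by
    have := (div_lt_iff₀ (by positivity)).mp (Int.lt_floor_add_one (h x₀ / (2 * Real.pi)))
    linarith
  have hhi' : h x₀ < 2 * Real.pi * k + Real.pi := by
    by_contra! hcon
    have h1 : Real.sin (h x₀ - 2 * Real.pi * k - Real.pi) = -Real.sin (h x₀) := by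
      rw [Real.sin_sub_pi, mul_comm (2 * Real.pi), Real.sin_sub_int_mul_two_pi]
    have h2 := Real.sin_nonneg_of_nonneg_of_le_pi
      (x := h x₀ - 2 * Real.pi * k - Real.pi) (by linarith) (by linarith)
    linarith [hsin x₀ hx₀]
  refine ⟨k, fun x hx => ⟨?_, ?_⟩⟩
  · by_contra! hcon
    obtain ⟨y, hy, hy'⟩ := hs.intermediate_value hx hx₀ hh ⟨hcon, hlo⟩
    have := hsin y hy
    rw [hy', hsin0] at this
    exact this.false
  · by_contra! hcon
    obtain ⟨y, hy, hy'⟩ := hs.intermediate_value hx₀ hx hh ⟨hhi'.le, hcon⟩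
    have := hsin y hy
    rw [hy', hsin1] at this
    exact this.false

/-- The Poincaré–Miranda theorem on the unit square. -/
lemma exists_eq_zero_of_sign_on_edges {u v : ℝ × ℝ → ℝ}
    (hu : ContinuousOn u (Icc 0 1 ×ˢ Icc 0 1)) (hv : ContinuousOn v (Icc 0 1 ×ˢ Icc 0 1))
    (hu0 : ∀ t ∈ Icc (0 : ℝ) 1, u (0, t) < 0) (hu1 : ∀ t ∈ Icc (0 : ℝ) 1, 0 < u (1, t))
    (hv0 : ∀ t ∈ Icc (0 : ℝ) 1, v (t, 0) < 0) (hv1 : ∀ t ∈ Icc (0 : ℝ) 1, 0 < v (t, 1)) :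
    ∃ z ∈ Icc (0 : ℝ) 1 ×ˢ Icc (0 : ℝ) 1, u z = 0 ∧ v z = 0 := by
  by_contra! hcon
  obtain ⟨g, hg, hexp⟩ := exists_continuousOn_exp_eq
    (K := Icc (0 : ℝ) 1 ×ˢ Icc (0 : ℝ) 1) (F := fun z => (u z : ℂ) + v z * Complex.I)
    (isCompact_Icc.prod isCompact_Icc)
    (by
      rintro ⟨x, y⟩ ⟨hx, hy⟩ t ht
      exact ⟨⟨mul_nonneg ht.1 hx.1, mul_le_one₀ ht.2 hx.1 hx.2⟩,
        ⟨mul_nonneg ht.1 hy.1, mul_le_one₀ ht.2 hy.1 hy.2⟩⟩)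
    (by fun_prop)
    (by
      intro z hz h0
      have hre := congrArg Complex.re h0
      have him := congrArg Complex.im h0
      simp at hre him
      exact hcon z hz hre him)
  have hucos : ∀ z ∈ Icc (0 : ℝ) 1 ×ˢ Icc (0 : ℝ) 1,
      u z = Real.exp (g z).re * Real.cos (g z).im := by
    intro z hz
    have := congrArg Complex.re (hexp z hz)
    rw [Complex.exp_re] at this
    simpa using this.symm
  have hvsin : ∀ z ∈ Icc (0 : ℝ) 1 ×ˢ Icc (0 : ℝ) 1,
      v z = Real.exp (g z).re * Real.sin (g z).im := by
    intro z hz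
    have := congrArg Complex.im (hexp z hz)
    rw [Complex.exp_im] at this
    simpa using this.symm
  have h0 : (0 : ℝ) ∈ Icc (0 : ℝ) 1 := by simp
  have h1 : (1 : ℝ) ∈ Icc (0 : ℝ) 1 := by simp
  have hθ : ContinuousOn (fun z => (g z).im) (Icc (0 : ℝ) 1 ×ˢ Icc (0 : ℝ) 1) :=
    Complex.continuous_im.comp_continuousOn hg
  have hvert : ∀ c ∈ Icc (0 : ℝ) 1, ContinuousOn (fun t => (g (c, t)).im) (Icc (0 : ℝ) 1) :=
    fun c hc => hθ.comp (f := fun t : ℝ => (c, t)) (by fun_prop) fun t ht => ⟨hc, ht⟩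
  have hhor : ∀ c ∈ Icc (0 : ℝ) 1, ContinuousOn (fun t => (g (t, c)).im) (Icc (0 : ℝ) 1) :=
    fun c hc => hθ.comp (f := fun t : ℝ => (t, c)) (by fun_prop) fun t ht => ⟨ht, hc⟩
  obtain ⟨kr, hkr⟩ := exists_int_forall_mem_Ioo_of_sin_pos isPreconnected_Icc
    (h := fun t : ℝ => (g (1, t)).im + Real.pi / 2) ((hvert 1 h1).add continuousOn_const)
    (fun t ht => by
      have := hu1 t ht
      rw [hucos _ ⟨h1, ht⟩] at this
      rw [Real.sin_add_pi_div_two]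
      exact (mul_pos_iff_of_pos_left (Real.exp_pos _)).mp this)
  obtain ⟨kt, hkt⟩ := exists_int_forall_mem_Ioo_of_sin_pos isPreconnected_Icc
    (hhor 1 h1)
    (fun t ht => by
      have := hv1 t ht
      rw [hvsin _ ⟨ht, h1⟩] at this
      exact (mul_pos_iff_of_pos_left (Real.exp_pos _)).mp this)
  obtain ⟨kl, hkl⟩ := exists_int_forall_mem_Ioo_of_sin_pos isPreconnected_Icc
    (h := fun t : ℝ => (g (0, t)).im - Real.pi / 2) ((hvert 0 h0).sub continuousOn_const)
    (fun t ht => by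
      have := hu0 t ht
      rw [hucos _ ⟨h0, ht⟩] at this
      rw [Real.sin_sub_pi_div_two]
      exact neg_pos.mpr (neg_of_mul_neg_right this (Real.exp_pos _).le))
  obtain ⟨kb, hkb⟩ := exists_int_forall_mem_Ioo_of_sin_pos isPreconnected_Icc
    (h := fun t : ℝ => (g (t, 0)).im - Real.pi) ((hhor 0 h0).sub continuousOn_const)
    (fun t ht => by
      have := hv0 t ht
      rw [hvsin _ ⟨ht, h0⟩] at this
      rw [Real.sin_sub_pi]
      exact neg_pos.mpr (neg_of_mul_neg_right this (Real.exp_pos _).le))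
  have hpi := Real.pi_pos
  have hlt : ∀ a b : ℤ, 2 * Real.pi * a < 2 * Real.pi * b + 2 * Real.pi → a ≤ b := by
    intro a b hab
    have : (a : ℝ) < b + 1 := by
      refine lt_of_mul_lt_mul_left (a := 2 * Real.pi) ?_ (by positivity)
      linarith
    exact Int.lt_add_one_iff.mp (by exact_mod_cast this)
  have hr1 := hkr 1 h1
  have hr0 := hkr 0 h0
  have ht1 := hkt 1 h1
  have ht0 := hkt 0 h0
  have hl1 := hkl 1 h1
  have hl0 := hkl 0 h0
  have hb1 := hkb 1 h1
  have hb0 := hkb 0 h0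
  simp only [mem_Ioo] at hr1 hr0 ht1 ht0 hl1 hl0 hb1 hb0
  have hrt : kr ≤ kt := hlt _ _ (by linarith)
  have htl : kt ≤ kl := hlt _ _ (by linarith)
  have hlb : kl ≤ kb := hlt _ _ (by linarith)
  have hbr : kb + 1 ≤ kr := hlt _ _ (by push_cast; linarith)
  lia

/-- Polynomials in two variables are uniformly dense in the continuous real functions on a compact
subset of the plane. -/
lemma exists_mvPolynomial_near_of_continuousOn {K : Set (ℝ × ℝ)} (hK : IsCompact K)
    {f : ℝ × ℝ → ℝ} (hf : ContinuousOn f K) {ε : ℝ} (hε : 0 < ε) :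
    ∃ p : MvPolynomial (Fin 2) ℝ, ∀ z ∈ K, |MvPolynomial.eval ![z.1, z.2] p - f z| < ε := by
  have : CompactSpace K := isCompact_iff_compactSpace.mp hK
  let X : Fin 2 → C(K, ℝ) := ![⟨fun z => z.1.1, by fun_prop⟩, ⟨fun z => z.1.2, by fun_prop⟩]
  have hsep : (MvPolynomial.aeval (R := ℝ) X).range.SeparatesPoints := by
    intro z w hzw
    by_cases h : z.1.1 = w.1.1
    · have h2 : z.1.2 ≠ w.1.2 := fun h2 => hzw (Subtype.ext (Prod.ext h h2))
      exact ⟨_, ⟨X 1, ⟨MvPolynomial.X 1, by simp⟩, rfl⟩, h2⟩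
    · exact ⟨_, ⟨X 0, ⟨MvPolynomial.X 0, by simp⟩, rfl⟩, h⟩
  obtain ⟨⟨_, p, rfl⟩, hp⟩ := ContinuousMap.exists_mem_subalgebra_near_continuous_of_separatesPoints
    _ hsep (K.domRestrict f) hf.domRestrict ε hε
  refine ⟨p, fun z hz => ?_⟩
  have heval : MvPolynomial.aeval X p ⟨z, hz⟩ = MvPolynomial.eval ![z.1, z.2] p := by
    have hX : (fun i => X i ⟨z, hz⟩) = ![z.1, z.2] := by
      funext i
      fin_cases i <;> rfl
    have := MvPolynomial.map_aeval X (ContinuousMap.evalAlgHom ℝ ℝ (⟨z, hz⟩ : K)).toRingHom p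
    simp only [MvPolynomial.eval, ← hX]
    exact this
  have := hp ⟨z, hz⟩
  rw [Real.norm_eq_abs] at this
  rw [← heval]
  exact this

/-- Points where two continuous functions compare in opposite ways lie in different connected
components of the complement of their coincidence set. -/
lemma connectedComponentIn_ne_of_lt_of_gt {X : Type*} [TopologicalSpace X] {s : Set X}
    {u v : X → ℝ} (hu : ContinuousOn u s) (hv : ContinuousOn v s) {a b : X}
    (ha : a ∈ s) (hb : b ∈ s) (hua : v a < u a) (hub : u b < v b) :
    connectedComponentIn (s \ {z ∈ s | u z = v z}) a ≠
      connectedComponentIn (s \ {z ∈ s | u z = v z}) b := by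
  intro h
  have ha' : a ∈ s \ {z ∈ s | u z = v z} := ⟨ha, fun h => hua.ne' h.2⟩
  have hb' : b ∈ s \ {z ∈ s | u z = v z} := ⟨hb, fun h => hub.ne h.2⟩
  have hsub := connectedComponentIn_subset (s \ {z ∈ s | u z = v z}) a
  obtain ⟨z, hz, hz'⟩ := isPreconnected_connectedComponentIn.intermediate_value₂
    (mem_connectedComponentIn ha') (h ▸ mem_connectedComponentIn hb')
    (hv.mono (hsub.trans sdiff_subset)) (hu.mono (hsub.trans sdiff_subset)) hua.le hub.le
  exact (hsub hz).2 ⟨(hsub hz).1, hz'.symm⟩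

/-- A continuous function on a compact plane set with values in the unit interval is uniformly
approximated by polynomials with values in the open unit interval. -/
lemma exists_mvPolynomial_mem_Ioo_near {K : Set (ℝ × ℝ)} (hK : IsCompact K)
    {f : ℝ × ℝ → ℝ} (hf : ContinuousOn f K) (hf01 : ∀ z ∈ K, f z ∈ Icc (0 : ℝ) 1)
    {ε : ℝ} (hε : 0 < ε) :
    ∃ p : MvPolynomial (Fin 2) ℝ, ∀ z ∈ K, MvPolynomial.eval ![z.1, z.2] p ∈ Ioo (0 : ℝ) 1 ∧
      |f z - MvPolynomial.eval ![z.1, z.2] p| ≤ ε := by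
  set δ := min (ε / 2) 1 with hδ
  have hδ0 : 0 < δ := by positivity
  have hδε : δ ≤ ε / 2 := min_le_left _ _
  have hδ1 : δ ≤ 1 := min_le_right _ _
  obtain ⟨p, hp⟩ := exists_mvPolynomial_near_of_continuousOn hK
    (f := fun z => (1 - δ) * f z + δ / 2) (by fun_prop) (half_pos hδ0)
  refine ⟨p, fun z hz => ?_⟩
  have h := abs_lt.mp (hp z hz)
  obtain ⟨h0, h1⟩ := hf01 z hz
  refine ⟨⟨?_, ?_⟩, abs_le.mpr ⟨?_, ?_⟩⟩ <;> nlinarith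

/-- Dense polynomial approximation with a fixed point realized as the intersection of
two algebraic curves, each of which separates the square into at least two connected
components. -/
theorem stmt_11
    (Q : Set (ℝ × ℝ)) (hQ : Q = Icc (0:ℝ) 1 ×ˢ Icc (0:ℝ) 1)
    (f : ℝ × ℝ → ℝ × ℝ) (hf : ContinuousOn f Q) (hfQ : MapsTo f Q Q)
    (ε : ℝ) (hε : 0 < ε) :
    ∃ p₁ p₂ : MvPolynomial (Fin 2) ℝ,
      (∀ z ∈ Q, (MvPolynomial.eval ![z.1, z.2] p₁, MvPolynomial.eval ![z.1, z.2] p₂) ∈ Q) ∧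
      (∀ z ∈ Q, ‖f z - (MvPolynomial.eval ![z.1, z.2] p₁, MvPolynomial.eval ![z.1, z.2] p₂)‖ ≤ ε) ∧
      ({z ∈ Q | MvPolynomial.eval ![z.1, z.2] p₁ = z.1} ∩
        {z ∈ Q | MvPolynomial.eval ![z.1, z.2] p₂ = z.2}).Nonempty ∧
      (∀ z ∈ {z ∈ Q | MvPolynomial.eval ![z.1, z.2] p₁ = z.1} ∩
          {z ∈ Q | MvPolynomial.eval ![z.1, z.2] p₂ = z.2},
        (MvPolynomial.eval ![z.1, z.2] p₁, MvPolynomial.eval ![z.1, z.2] p₂) = z) ∧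
      (∃ a ∈ Q \ {z ∈ Q | MvPolynomial.eval ![z.1, z.2] p₁ = z.1},
       ∃ b ∈ Q \ {z ∈ Q | MvPolynomial.eval ![z.1, z.2] p₁ = z.1},
        connectedComponentIn (Q \ {z ∈ Q | MvPolynomial.eval ![z.1, z.2] p₁ = z.1}) a ≠
        connectedComponentIn (Q \ {z ∈ Q | MvPolynomial.eval ![z.1, z.2] p₁ = z.1}) b) ∧
      (∃ a ∈ Q \ {z ∈ Q | MvPolynomial.eval ![z.1, z.2] p₂ = z.2},
       ∃ b ∈ Q \ {z ∈ Q | MvPolynomial.eval ![z.1, z.2] p₂ = z.2},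
        connectedComponentIn (Q \ {z ∈ Q | MvPolynomial.eval ![z.1, z.2] p₂ = z.2}) a ≠
        connectedComponentIn (Q \ {z ∈ Q | MvPolynomial.eval ![z.1, z.2] p₂ = z.2}) b) := by
  subst hQ
  have hK : IsCompact (Icc (0 : ℝ) 1 ×ˢ Icc (0 : ℝ) 1) := isCompact_Icc.prod isCompact_Icc
  obtain ⟨p₁, hp₁⟩ := exists_mvPolynomial_mem_Ioo_near hK (f := fun z => (f z).1) (by fun_prop)
    (fun z hz => (hfQ hz).1) hε
  obtain ⟨p₂, hp₂⟩ := exists_mvPolynomial_mem_Ioo_near hK (f := fun z => (f z).2) (by fun_prop)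
    (fun z hz => (hfQ hz).2) hε
  have hcont (p : MvPolynomial (Fin 2) ℝ) :
      Continuous fun z : ℝ × ℝ => MvPolynomial.eval ![z.1, z.2] p :=
    (MvPolynomial.continuous_eval p).comp (by fun_prop)
  have h0 : (0 : ℝ) ∈ Icc (0 : ℝ) 1 := by simp
  have h1 : (1 : ℝ) ∈ Icc (0 : ℝ) 1 := by simp
  have h00 : ((0, 0) : ℝ × ℝ) ∈ Icc (0 : ℝ) 1 ×ˢ Icc (0 : ℝ) 1 := ⟨h0, h0⟩
  have h10 : ((1, 0) : ℝ × ℝ) ∈ Icc (0 : ℝ) 1 ×ˢ Icc (0 : ℝ) 1 := ⟨h1, h0⟩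
  have h01 : ((0, 1) : ℝ × ℝ) ∈ Icc (0 : ℝ) 1 ×ˢ Icc (0 : ℝ) 1 := ⟨h0, h1⟩
  refine ⟨p₁, p₂, fun z hz => ?_, fun z hz => ?_, ?_, fun z hz => Prod.ext hz.1.2 hz.2.2,
    ⟨(0, 0), ⟨h00, fun h => (hp₁ _ h00).1.1.ne' h.2⟩, (1, 0),
      ⟨h10, fun h => (hp₁ _ h10).1.2.ne h.2⟩,
      connectedComponentIn_ne_of_lt_of_gt (hcont p₁).continuousOn continuousOn_fst h00 h10
        (hp₁ _ h00).1.1 (hp₁ _ h10).1.2⟩,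
    ⟨(0, 0), ⟨h00, fun h => (hp₂ _ h00).1.1.ne' h.2⟩, (0, 1),
      ⟨h01, fun h => (hp₂ _ h01).1.2.ne h.2⟩,
      connectedComponentIn_ne_of_lt_of_gt (hcont p₂).continuousOn continuousOn_snd h00 h01
        (hp₂ _ h00).1.1 (hp₂ _ h01).1.2⟩⟩
  · exact ⟨Ioo_subset_Icc_self (hp₁ z hz).1, Ioo_subset_Icc_self (hp₂ z hz).1⟩
  · exact max_le (hp₁ z hz).2 (hp₂ z hz).2
  · obtain ⟨z, hz, hz1, hz2⟩ := exists_eq_zero_of_sign_on_edges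
      (u := fun z => z.1 - MvPolynomial.eval ![z.1, z.2] p₁)
      (v := fun z => z.2 - MvPolynomial.eval ![z.1, z.2] p₂)
      (continuous_fst.sub (hcont p₁)).continuousOn (continuous_snd.sub (hcont p₂)).continuousOn
      (fun t ht => sub_neg.mpr (hp₁ (0, t) ⟨h0, ht⟩).1.1)
      (fun t ht => sub_pos.mpr (hp₁ (1, t) ⟨h1, ht⟩).1.2)
      (fun t ht => sub_neg.mpr (hp₂ (t, 0) ⟨ht, h0⟩).1.1)
      (fun t ht => sub_pos.mpr (hp₂ (t, 1) ⟨ht, h1⟩).1.2)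
    exact ⟨z, ⟨hz, (sub_eq_zero.mp hz1).symm⟩, ⟨hz, (sub_eq_zero.mp hz2).symm⟩⟩
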